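/- Let G be a finite simple graph with four distinct vertices u, v, w, z such that uz, wz, vw are edges of G and uv, uw, vz are not edges of G. Suppose there is a graph automorphism φ of G − wz (the graph G with the edge wz removed) satisfying φ(u) = z, φ(z) = u, φ(w) = v, φ(v) = w. Let H = G + uw and J = G + vz be the graphs obtained from G by adding the edge uw, respectively vz. Define A = #{ x ∈ V(G) ∖ {u,v,w,z} : xw ∈ E(G), xu ∉ E(G), xv ∉ E(G) }, B = #{ x ∈ V(G) ∖ {u,v,w,z} : xw ∈ E(G), xz ∉ E(G), xv ∉ E(G) }, A′ = #{ x ∈ V(G) ∖ {u,v,w,z} : xz ∈ E(G), xu ∉ E(G), xv ∉ E(G) }, B′ = #{ x ∈ V(G) ∖ {u,v,w,z} : xz ∈ E(G), xu ∉ E(G), xw ∉ E(G) }. If A + B ≠ A′ + B′, then X̄_H ≠ X̄_J. -/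

import Mathlib

/-- The Kromatic symmetric function of a simple graph `G`. -/
noncomputable def KSF {V : Type} (G : SimpleGraph V) : MvPowerSeries ℕ+ ℤ :=
  fun d => (Nat.card {κ : V → Finset ℕ+ //
    (∀ v, (κ v).Nonempty) ∧
    (∀ ⦃a b : V⦄, G.Adj a b → Disjoint (κ a) (κ b)) ∧
    (∀ i : ℕ+, Nat.card {v : V // i ∈ κ v} = d i)} : ℤ)


/-- `S` is an independent set of `K`. -/
def SpansNoEdge {V : Type} (K : SimpleGraph V) (S : Finset V) : Prop :=
  ∀ a ∈ S, ∀ b ∈ S, ¬ K.Adj a b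

open scoped Classical in
/-- The number of independent sets of size `k` contained in `W`. -/
noncomputable def indepCount {V : Type} (K : SimpleGraph V) (W : Finset V) (k : ℕ) : ℕ :=
  ((W.powersetCard k).filter (SpansNoEdge K)).card

/-- `W` induces a claw `K_{1,3}` in `K`. -/
def IsClaw {V : Type} (K : SimpleGraph V) (W : Finset V) : Prop :=
  W.card = 4 ∧ ∃ c ∈ W, ∀ x ∈ W, x ≠ c → K.Adj c x ∧ ∀ y ∈ W, y ≠ c → ¬ K.Adj x y

section KSF

variable {V : Type} [Fintype V] (K : SimpleGraph V)

open scoped Classical in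
/-- Proper set colorings, seen as covers of the vertex set by independent sets. -/
theorem KSF_eq_card_covers (d : ℕ+ →₀ ℕ) :
    KSF K d = (((Fintype.piFinset fun i : d.support =>
      ((Finset.univ : Finset V).powersetCard (d i)).filter (SpansNoEdge K)).filter
      fun S => ∀ v, ∃ i, v ∈ S i).card : ℤ) := by
  rw [KSF, Nat.cast_inj, ← Nat.card_eq_finsetCard]
  refine Nat.card_congr
    { toFun := fun κ => ⟨fun i => Finset.univ.filter fun v => (i : ℕ+) ∈ κ.1 v, ?_⟩
      invFun := fun S => ⟨fun v => (Finset.univ.filter fun i => v ∈ S.1 i).map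
        (Function.Embedding.subtype _), ?_⟩
      left_inv := ?_
      right_inv := ?_ }
  · obtain ⟨κ, hne, hdisj, hd⟩ := κ
    simp only [Nat.card_eq_fintype_card, Fintype.card_subtype] at hd
    simp only [Finset.mem_filter, Fintype.mem_piFinset, Finset.mem_powersetCard,
      Finset.subset_univ, true_and, Finset.mem_univ, SpansNoEdge]
    refine ⟨fun i => ⟨hd i, fun a ha b hb hab => Finset.disjoint_left.mp (hdisj hab) ha hb⟩,
      fun v => ?_⟩
    obtain ⟨i, hi⟩ := hne v
    refine ⟨⟨i, ?_⟩, hi⟩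
    rw [Finsupp.mem_support_iff, ← hd i, Finset.card_ne_zero]
    exact ⟨v, by simpa using hi⟩
  · obtain ⟨S, hS⟩ := S
    simp only [Finset.mem_filter, Fintype.mem_piFinset, Finset.mem_powersetCard,
      Finset.subset_univ, true_and] at hS
    obtain ⟨hS, hcov⟩ := hS
    refine ⟨fun v => ?_, fun a b hab => ?_, fun i => ?_⟩
    · obtain ⟨i, hi⟩ := hcov v
      exact ⟨i, by simpa using hi⟩
    · rw [Finset.disjoint_left]
      simp only [Finset.mem_map, Finset.mem_filter, Finset.mem_univ, true_and]
      rintro _ ⟨i, hi, rfl⟩ ⟨j, hj, hji⟩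
      obtain rfl := Subtype.ext hji
      exact (hS j).2 a hi b hj hab
    · by_cases hi : i ∈ d.support
      · rw [← (hS ⟨i, hi⟩).1, ← Nat.card_eq_finsetCard]
        refine Nat.card_congr (Equiv.subtypeEquivRight fun v => ?_)
        simp only [Finset.mem_map, Finset.mem_filter, Finset.mem_univ, true_and,
          Function.Embedding.subtype_apply]
        exact ⟨by rintro ⟨j, hj, rfl⟩; exact hj, fun h => ⟨_, h, rfl⟩⟩
      · rw [Finsupp.notMem_support_iff.mp hi, Nat.card_eq_zero]
        refine .inl ⟨fun ⟨v, hv⟩ => hi ?_⟩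
        obtain ⟨j, -, rfl⟩ := Finset.mem_map.mp hv
        exact j.2
  · rintro ⟨κ, hne, hdisj, hd⟩
    simp only [Nat.card_eq_fintype_card, Fintype.card_subtype] at hd
    ext v i
    simp only [Finset.mem_map, Finset.mem_filter, Finset.mem_univ, true_and,
      Function.Embedding.subtype_apply]
    refine ⟨by rintro ⟨j, hj, rfl⟩; exact hj, fun hi => ⟨⟨i, ?_⟩, hi, rfl⟩⟩
    rw [Finsupp.mem_support_iff, ← hd i, Finset.card_ne_zero]
    exact ⟨v, by simpa using hi⟩
  · rintro ⟨S, hS⟩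
    ext i v
    simp

open scoped Classical in
theorem sum_neg_one_pow_card_compl_of_subset (U : Finset V) :
    ∑ W : Finset V, (if U ⊆ W then (-1 : ℤ) ^ Wᶜ.card else 0) =
      if U = Finset.univ then 1 else 0 := by
  have h := Finset.sum_powerset_neg_one_pow_card (x := Uᶜ)
  simp only [Finset.compl_eq_empty_iff] at h
  rw [← h, ← Finset.sum_filter]
  refine Finset.sum_nbij' (fun W => Wᶜ) (fun W => Wᶜ) ?_ ?_ ?_ ?_ ?_
  · intro W hW; simpa using hW
  · intro W hW
    rw [Finset.mem_powerset] at hW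
    simpa using Finset.subset_compl_comm.mp hW
  all_goals simp

open scoped Classical in
/-- Inclusion-exclusion over the set of covered vertices. -/
theorem KSF_eq_sum (d : ℕ+ →₀ ℕ) :
    KSF K d = ∑ W : Finset V, (-1 : ℤ) ^ Wᶜ.card * d.prod fun _ k => (indepCount K W k : ℤ) := by
  set P := Fintype.piFinset fun i : d.support =>
      ((Finset.univ : Finset V).powersetCard (d i)).filter (SpansNoEdge K) with hP
  have hprod (W : Finset V) : (d.prod fun _ k => (indepCount K W k : ℤ)) =
      ∑ S ∈ P, if Finset.univ.biUnion S ⊆ W then 1 else 0 := by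
    rw [Finset.sum_boole, Finsupp.prod, ← Finset.prod_coe_sort, ← Nat.cast_prod]
    simp only [indepCount]
    rw [← Fintype.card_piFinset]
    congr 2
    ext S
    simp only [hP, Fintype.mem_piFinset, Finset.mem_filter, Finset.mem_powersetCard,
      Finset.biUnion_subset, Finset.mem_univ, Finset.subset_univ, true_and, true_imp_iff,
      ← forall_and]
    exact forall_congr' fun i => by tauto
  rw [KSF_eq_card_covers, ← hP, ← Finset.sum_boole]
  simp_rw [hprod, Finset.mul_sum]
  rw [Finset.sum_comm]
  refine Finset.sum_congr rfl fun S _ => ?_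
  simp only [mul_ite, mul_one, mul_zero]
  rw [sum_neg_one_pow_card_compl_of_subset]
  simp [Finset.eq_univ_iff_forall]

open scoped Classical in
/-- The KSF determines the signed sum, over all vertex subsets, of any polynomial in the numbers of
independent sets of positive sizes. -/
theorem sum_eval_indepCount_eq_of_KSF_eq {H J : SimpleGraph V} (h : KSF H = KSF J)
    (p : MvPolynomial ℕ ℚ) (d : ℕ+ →₀ ℕ) :
    ∑ W : Finset V, (-1 : ℚ) ^ Wᶜ.card * (d.prod fun _ k => (indepCount H W k : ℚ)) *
        p.eval (fun k => (indepCount H W (k + 1) : ℚ)) =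
      ∑ W : Finset V, (-1 : ℚ) ^ Wᶜ.card * (d.prod fun _ k => (indepCount J W k : ℚ)) *
        p.eval (fun k => (indepCount J W (k + 1) : ℚ)) := by
  induction p using MvPolynomial.induction_on generalizing d with
  | C a =>
    have hd := congrArg (Int.cast : ℤ → ℚ) (congrFun h d)
    rw [KSF_eq_sum, KSF_eq_sum] at hd
    simp only [Finsupp.prod] at hd
    push_cast at hd
    simp only [MvPolynomial.eval_C, ← Finset.sum_mul, Finsupp.prod, hd]
  | add p q hp hq => simp only [map_add, mul_add, Finset.sum_add_distrib, hp, hq]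
  | mul_X p k hp =>
    obtain ⟨i, hi⟩ := Infinite.exists_notMem_finset d.support
    have key (f : ℕ → ℚ) : ((d + Finsupp.single i (k + 1)).prod fun _ k => f k) =
        (d.prod fun _ k => f k) * f (k + 1) := by
      rw [Finsupp.prod_add_index_of_disjoint]
      · congr 1
        rw [Finsupp.prod, Finsupp.support_single _ k.succ_ne_zero, Finset.prod_singleton,
          Finsupp.single_eq_same]
      · rw [Finsupp.support_single _ k.succ_ne_zero]
        simpa using hi
    have := hp (d + Finsupp.single i (k + 1))
    simp only [key fun k => (indepCount H _ k : ℚ), key fun k => (indepCount J _ k : ℚ)] at this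
    simp only [map_mul, MvPolynomial.eval_X]
    convert this using 2 <;> ring

end KSF

section Claw

variable {V : Type} {K L : SimpleGraph V} {W : Finset V}

theorem indepCount_one : indepCount K W 1 = W.card := by
  classical
  rw [indepCount, Finset.filter_true_of_mem, Finset.card_powersetCard, Nat.choose_one_right]
  intro S hS
  obtain ⟨a, rfl⟩ := Finset.card_eq_one.mp (Finset.mem_powersetCard.mp hS).2
  simp [SpansNoEdge]

/-- Claws are recognized by their independence numbers. -/
theorem isClaw_iff_indepCount :
    IsClaw K W ↔ indepCount K W 1 = 4 ∧ indepCount K W 2 = 3 ∧ indepCount K W 3 = 1 := by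
  classical
  rw [indepCount_one]
  constructor
  · rintro ⟨hW, c, hc, h⟩
    have hT : (W.erase c).card = 3 := by rw [Finset.card_erase_of_mem hc, hW]
    have key (k : ℕ) (hk : 2 ≤ k) : indepCount K W k = ((W.erase c).powersetCard k).card := by
      rw [indepCount]
      congr 1
      ext S
      simp only [Finset.mem_filter, Finset.mem_powersetCard, SpansNoEdge]
      constructor
      · rintro ⟨⟨hSW, rfl⟩, hS⟩
        refine ⟨fun x hx => Finset.mem_erase.mpr ⟨?_, hSW hx⟩, rfl⟩
        rintro rfl
        obtain ⟨y, hy, hyx⟩ := Finset.exists_mem_ne (by omega : 1 < S.card) x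
        exact hS x hx y hy (h y (hSW hy) hyx).1
      · rintro ⟨hS, rfl⟩
        refine ⟨⟨hS.trans (Finset.erase_subset _ _), rfl⟩, fun a ha b hb => ?_⟩
        have ha := Finset.mem_erase.mp (hS ha)
        have hb := Finset.mem_erase.mp (hS hb)
        exact (h a ha.2 ha.1).2 b hb.2 hb.1
    refine ⟨hW, ?_, ?_⟩ <;> rw [key _ (by norm_num), Finset.card_powersetCard, hT] <;> rfl
  · rintro ⟨hW, h2, h3⟩
    obtain ⟨T, hT⟩ := Finset.card_pos.mp (h3 ▸ Nat.one_pos : 0 < indepCount K W 3)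
    rw [Finset.mem_filter, Finset.mem_powersetCard] at hT
    obtain ⟨⟨hTW, hT3⟩, hind⟩ := hT
    obtain ⟨c, hc⟩ := Finset.card_eq_one.mp
      (show (W \ T).card = 1 by rw [Finset.card_sdiff_of_subset hTW]; omega)
    have hmem (x : V) : x ∈ W ∧ x ∉ T ↔ x = c := by
      rw [← Finset.mem_sdiff, hc, Finset.mem_singleton]
    have hcW := (hmem c).mpr rfl
    have hxT (x : V) (hx : x ∈ W) (hxc : x ≠ c) : x ∈ T := by
      by_contra hn; exact hxc ((hmem x).mp ⟨hx, hn⟩)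
    have heq := Finset.eq_of_subset_of_card_le
      (show T.powersetCard 2 ⊆ (W.powersetCard 2).filter (SpansNoEdge K) from fun S hS => by
        rw [Finset.mem_powersetCard] at hS
        exact Finset.mem_filter.mpr ⟨Finset.mem_powersetCard.mpr ⟨hS.1.trans hTW, hS.2⟩,
          fun a ha b hb => hind a (hS.1 ha) b (hS.1 hb)⟩)
      (by rw [Finset.card_powersetCard, hT3]; exact h2.le)
    refine ⟨hW, c, hcW.1, fun x hx hxc => ⟨?_, fun y hy hyc => hind x (hxT x hx hxc) y
      (hxT y hy hyc)⟩⟩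
    by_contra hadj
    have : ({c, x} : Finset V) ∈ T.powersetCard 2 := by
      rw [heq, Finset.mem_filter, Finset.mem_powersetCard]
      refine ⟨⟨?_, Finset.card_pair hxc.symm⟩, ?_⟩
      · simp [Finset.insert_subset_iff, hcW.1, hx]
      · simp [SpansNoEdge, hadj, K.adj_comm x c]
    exact hcW.2 ((Finset.mem_powersetCard.mp this).1 (by simp))

theorem IsClaw.congr (h : ∀ x ∈ W, ∀ y ∈ W, K.Adj x y ↔ L.Adj x y) : IsClaw K W ↔ IsClaw L W := by
  unfold IsClaw
  grind

theorem IsClaw.not_triangle (h : IsClaw K W) {p q r : V} (hp : p ∈ W) (hq : q ∈ W) (hr : r ∈ W)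
    (hpq : K.Adj p q) (hqr : K.Adj q r) : ¬ K.Adj p r := by
  obtain ⟨-, c, hc, h⟩ := h
  have := hpq.ne
  have := hqr.ne
  intro hpr
  have := hpr.ne
  by_cases p = c <;> by_cases q = c <;> by_cases r = c <;> grind [SimpleGraph.adj_comm]

theorem IsClaw.not_single_edge (h : IsClaw K W) {p q r : V} (hp : p ∈ W) (hq : q ∈ W)
    (hr : r ∈ W) (hrp : r ≠ p) (hrq : r ≠ q) (hpq : K.Adj p q) (hqr : ¬ K.Adj q r) :
    K.Adj p r := by
  obtain ⟨-, c, hc, h⟩ := h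
  have := hpq.ne
  by_cases p = c <;> by_cases q = c <;> by_cases r = c <;> grind [SimpleGraph.adj_comm]

variable [Fintype V]

open scoped Classical in
theorem card_isClaw_eq_of_KSF_eq {H J : SimpleGraph V} (h : KSF H = KSF J) :
    (Finset.univ.filter (IsClaw H)).card = (Finset.univ.filter (IsClaw J)).card := by
  let N : Finset ℕ := Finset.univ.biUnion fun W : Finset V => Finset.univ.biUnion fun k : Fin 4 =>
    {indepCount H W k, indepCount J W k, 4, 3, 1}
  let b (c : ℕ) : Polynomial ℚ := Lagrange.basis N (fun n => (n : ℚ)) c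
  have hb (c n : ℕ) (hc : c ∈ N) (hn : n ∈ N) : (b c).eval (n : ℚ) = if n = c then 1 else 0 := by
    have hinj : Set.InjOn (fun n : ℕ => (n : ℚ)) N := Nat.cast_injective.injOn
    split_ifs with hnc
    · subst hnc; exact Lagrange.eval_basis_self hinj hn
    · exact Lagrange.eval_basis_of_ne (v := fun n : ℕ => (n : ℚ)) (Ne.symm hnc) hn
  let p : MvPolynomial ℕ ℚ := Polynomial.aeval (MvPolynomial.X 0) (b 4) *
    Polynomial.aeval (MvPolynomial.X 1) (b 3) * Polynomial.aeval (MvPolynomial.X 2) (b 1)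
  have hp (f : ℕ → ℚ) : p.eval f = (b 4).eval (f 0) * (b 3).eval (f 1) * (b 1).eval (f 2) := by
    have (q : Polynomial ℚ) (k : ℕ) :
        MvPolynomial.eval f (Polynomial.aeval (MvPolynomial.X k) q) = q.eval (f k) := by
      induction q using Polynomial.induction_on' with
      | add p q hp hq => simp [hp, hq]
      | monomial n a => simp [Polynomial.aeval_monomial]
    simp only [p, map_mul, this]
  have hN (n : ℕ) (W : Finset V) (k : Fin 4)
      (hn : n = indepCount H W k ∨ n = indepCount J W k ∨ n = 4 ∨ n = 3 ∨ n = 1) : n ∈ N := by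
    simp only [N, Finset.mem_biUnion, Finset.mem_univ, true_and]
    exact ⟨W, k, by simpa using hn⟩
  have hcount (K : SimpleGraph V) (hK : ∀ W, ∀ k : Fin 4, indepCount K W k ∈ N) :
      ∑ W : Finset V, (-1 : ℚ) ^ Wᶜ.card *
        ((0 : ℕ+ →₀ ℕ).prod fun _ k => (indepCount K W k : ℚ)) *
        p.eval (fun k => (indepCount K W (k + 1) : ℚ)) =
      (-1) ^ (Fintype.card V - 4) * ((Finset.univ.filter (IsClaw K)).card : ℚ) := by
    rw [← Finset.sum_boole, Finset.mul_sum]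
    refine Finset.sum_congr rfl fun W _ => ?_
    rw [hp]
    change _ * ((b 4).eval (indepCount K W (1 : Fin 4) : ℚ) *
      (b 3).eval (indepCount K W (2 : Fin 4) : ℚ) *
      (b 1).eval (indepCount K W (3 : Fin 4) : ℚ)) = _
    rw [hb 4 _ (hN _ W 0 (by simp)) (hK W 1), hb 3 _ (hN _ W 0 (by simp)) (hK W 2),
      hb 1 _ (hN _ W 0 (by simp)) (hK W 3)]
    by_cases hW : IsClaw K W
    · obtain ⟨a1, a2, a3⟩ := isClaw_iff_indepCount.mp hW
      simp [hW, a1, a2, a3, Finset.card_compl, hW.1]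
    · rw [if_neg hW]
      rw [isClaw_iff_indepCount] at hW
      simp only [Finsupp.prod_zero_index]
      norm_num
      tauto
  have := sum_eval_indepCount_eq_of_KSF_eq h p 0
  rw [hcount H fun W k => hN _ W k (by simp), hcount J fun W k => hN _ W k (by simp)] at this
  have := mul_left_cancel₀ (by simp) this
  exact_mod_cast this

open scoped Classical in
theorem card_isClaw_eq_of_iso (f : K ≃g L) :
    (Finset.univ.filter (IsClaw K)).card = (Finset.univ.filter (IsClaw L)).card := by
  refine Finset.card_equiv f.toEquiv.finsetCongr fun W => ?_
  simp only [Finset.mem_filter, Finset.mem_univ, true_and, Equiv.finsetCongr_apply, IsClaw,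
    Finset.card_map]
  refine and_congr_right fun _ => ?_
  simp only [Finset.forall_mem_map]
  refine .trans ?_ f.surjective.exists.symm
  have hmem (x : V) : f x ∈ W.map f.toEquiv.toEmbedding ↔ x ∈ W := Finset.mem_map' _
  simp [-Finset.mem_map_equiv, hmem, ← f.map_adj_iff]

open scoped Classical in
/-- Claws containing a given induced path are determined by their fourth vertex. -/
theorem card_isClaw_of_path {p q r : V} (hpq : K.Adj p q) (hqr : K.Adj q r) (hne : p ≠ r)
    (hpr : ¬ K.Adj p r) :
    (Finset.univ.filter fun W => IsClaw K W ∧ p ∈ W ∧ q ∈ W ∧ r ∈ W).card =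
      Nat.card {x : V // x ≠ p ∧ x ≠ q ∧ x ≠ r ∧ K.Adj x q ∧ ¬ K.Adj x p ∧ ¬ K.Adj x r} := by
  rw [Nat.card_eq_fintype_card, Fintype.card_subtype]
  symm
  have hpq' := hpq.ne
  have hqr' := hqr.ne
  refine Finset.card_bij (fun x _ => {x, p, q, r}) ?_ ?_ ?_
  · intro x hx
    simp only [Finset.mem_filter, Finset.mem_univ, true_and] at hx ⊢
    obtain ⟨hxp, hxq, hxr, hx⟩ := hx
    refine ⟨⟨by simp [*], q, by simp, ?_⟩, by simp, by simp, by simp⟩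
    simp only [Finset.mem_insert, Finset.mem_singleton]
    grind [SimpleGraph.adj_comm, SimpleGraph.irrefl]
  · intro x hx y hy hxy
    simp only [Finset.mem_filter, Finset.mem_univ, true_and] at hx hy
    have : x ∈ ({y, p, q, r} : Finset V) := hxy ▸ by simp
    simp only [Finset.mem_insert, Finset.mem_singleton] at this
    tauto
  · intro W hW
    simp only [Finset.mem_filter, Finset.mem_univ, true_and] at hW
    obtain ⟨hclaw, hp, hq, hr⟩ := hW
    have hsub : ({p, q, r} : Finset V) ⊆ W := by
      simp [Finset.insert_subset_iff, *]
    have h3 : ({p, q, r} : Finset V).card = 3 := by simp [*]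
    obtain ⟨x, hx⟩ := Finset.card_eq_one.mp (show (W \ {p, q, r}).card = 1 by
      rw [Finset.card_sdiff_of_subset hsub, hclaw.1, h3])
    have hxW : x ∈ W \ {p, q, r} := by simp [hx]
    have hWx : W = {x, p, q, r} := by
      rw [← Finset.sdiff_union_of_subset hsub, hx]; rfl
    simp only [Finset.mem_sdiff, Finset.mem_insert, Finset.mem_singleton, not_or] at hxW
    refine ⟨x, ?_, hWx.symm⟩
    simp only [Finset.mem_filter, Finset.mem_univ, true_and]
    refine ⟨hxW.2.1, hxW.2.2.1, hxW.2.2.2, ?_⟩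
    obtain ⟨-, c, hc, h⟩ := hclaw
    grind [SimpleGraph.adj_comm]

open scoped Classical in
theorem card_isClaw_split (K : SimpleGraph V) (u v w z : V) :
    (Finset.univ.filter (IsClaw K)).card =
      (Finset.univ.filter fun W => IsClaw K W ∧ ¬ (w ∈ W ∧ z ∈ W)).card +
      (Finset.univ.filter fun W => IsClaw K W ∧ (w ∈ W ∧ z ∈ W) ∧ (u ∈ W ∨ v ∈ W)).card +
      (Finset.univ.filter fun W => IsClaw K W ∧ (w ∈ W ∧ z ∈ W) ∧ ¬ (u ∈ W ∨ v ∈ W)).card := by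
  rw [← Finset.card_filter_add_card_filter_not (s := Finset.univ.filter (IsClaw K))
      (fun W => w ∈ W ∧ z ∈ W),
    ← Finset.card_filter_add_card_filter_not
      (s := (Finset.univ.filter (IsClaw K)).filter fun W => w ∈ W ∧ z ∈ W)
      fun W => u ∈ W ∨ v ∈ W]
  simp only [Finset.filter_filter, and_assoc]
  omega

open scoped Classical in
/-- The effect on the number of claws of deleting `wz` from `G + uw`, when `G` contains the
path `v, w, z, u` but not the edge `vz`. -/
theorem card_isClaw_sup_edge (G : SimpleGraph V) {u v w z : V} (huv : u ≠ v) (huw : u ≠ w)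
    (huz : u ≠ z) (hvw : v ≠ w) (hvz : v ≠ z) (hwz : w ≠ z)
    (h1 : G.Adj u z) (h2 : G.Adj w z) (h3 : G.Adj v w)
    (h4 : ¬ G.Adj v z) :
    (Finset.univ.filter (IsClaw (G ⊔ SimpleGraph.edge u w))).card +
      Nat.card {x : V // x ≠ u ∧ x ≠ v ∧ x ≠ w ∧ x ≠ z ∧
        G.Adj x u ∧ ¬ G.Adj x w ∧ ¬ G.Adj x z} +
      (Finset.univ.filter fun W => IsClaw (G.deleteEdges {s(w, z)}) W ∧
        (w ∈ W ∧ z ∈ W) ∧ ¬ (u ∈ W ∨ v ∈ W)).card =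
    (Finset.univ.filter (IsClaw (G.deleteEdges {s(w, z)} ⊔ SimpleGraph.edge u w))).card +
      Nat.card {x : V // x ≠ u ∧ x ≠ v ∧ x ≠ w ∧ x ≠ z ∧
        G.Adj x w ∧ ¬ G.Adj x z ∧ ¬ G.Adj x v} +
      (Finset.univ.filter fun W => IsClaw G W ∧ (w ∈ W ∧ z ∈ W) ∧ ¬ (u ∈ W ∨ v ∈ W)).card := by
  obtain ⟨H, hH⟩ : ∃ K, K = G ⊔ SimpleGraph.edge u w := ⟨_, rfl⟩
  obtain ⟨D, hD⟩ : ∃ K, K = G.deleteEdges {s(w, z)} := ⟨_, rfl⟩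
  obtain ⟨L, hL⟩ : ∃ K, K = D ⊔ SimpleGraph.edge u w := ⟨_, rfl⟩
  rw [← hH, ← hD, ← hL]
  have aH (x y : V) : H.Adj x y ↔ G.Adj x y ∨ (x = u ∧ y = w) ∨ (x = w ∧ y = u) := by
    rw [hH, SimpleGraph.sup_adj, SimpleGraph.edge_adj]; grind
  have aD (x y : V) : D.Adj x y ↔ G.Adj x y ∧ ¬ (x = w ∧ y = z) ∧ ¬ (x = z ∧ y = w) := by
    rw [hD, SimpleGraph.deleteEdges_adj, Set.mem_singleton_iff, Sym2.eq_iff]; tauto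
  have aL (x y : V) : L.Adj x y ↔ D.Adj x y ∨ (x = u ∧ y = w) ∨ (x = w ∧ y = u) := by
    rw [hL, SimpleGraph.sup_adj, SimpleGraph.edge_adj]; grind
  clear hH hD hL
  have sH := card_isClaw_split H u v w z
  have sL := card_isClaw_split L u v w z
  have eHL : (Finset.univ.filter fun W => IsClaw H W ∧ ¬ (w ∈ W ∧ z ∈ W)) =
      Finset.univ.filter fun W => IsClaw L W ∧ ¬ (w ∈ W ∧ z ∈ W) :=
    Finset.filter_congr fun W _ => and_congr_left fun hW =>
      IsClaw.congr fun x hx y hy => by rw [aH, aL, aD]; grind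
  have eHG : (Finset.univ.filter fun W => IsClaw H W ∧ (w ∈ W ∧ z ∈ W) ∧ ¬ (u ∈ W ∨ v ∈ W)) =
      Finset.univ.filter fun W => IsClaw G W ∧ (w ∈ W ∧ z ∈ W) ∧ ¬ (u ∈ W ∨ v ∈ W) :=
    Finset.filter_congr fun W _ => and_congr_left fun hW =>
      IsClaw.congr fun x hx y hy => by rw [aH]; grind
  have eLD : (Finset.univ.filter fun W => IsClaw L W ∧ (w ∈ W ∧ z ∈ W) ∧ ¬ (u ∈ W ∨ v ∈ W)) =
      Finset.univ.filter fun W => IsClaw D W ∧ (w ∈ W ∧ z ∈ W) ∧ ¬ (u ∈ W ∨ v ∈ W) :=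
    Finset.filter_congr fun W _ => and_congr_left fun hW =>
      IsClaw.congr fun x hx y hy => by rw [aL]; grind
  have pH : (Finset.univ.filter fun W => IsClaw H W ∧ (w ∈ W ∧ z ∈ W) ∧ (u ∈ W ∨ v ∈ W)) =
      Finset.univ.filter fun W => IsClaw H W ∧ v ∈ W ∧ w ∈ W ∧ z ∈ W := by
    refine Finset.filter_congr fun W _ => and_congr_right fun hW => ?_
    have : u ∈ W → w ∈ W → z ∈ W → False := fun hu hw hz =>
      hW.not_triangle hu hw hz (by simp [aH]) (by simp [aH, h2]) (by simp [aH, h1])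
    tauto
  have pL : (Finset.univ.filter fun W => IsClaw L W ∧ (w ∈ W ∧ z ∈ W) ∧ (u ∈ W ∨ v ∈ W)) =
      Finset.univ.filter fun W => IsClaw L W ∧ w ∈ W ∧ u ∈ W ∧ z ∈ W := by
    refine Finset.filter_congr fun W _ => and_congr_right fun hW => ?_
    have : v ∈ W → w ∈ W → z ∈ W → False := fun hv hw hz => by
      have := hW.not_single_edge hv hw hz hvz.symm hwz.symm (by simp [aL, aD, h3, hvw, hvz])
        (by simp [aL, aD, hwz, huz.symm, hwz.symm])
      simp [aL, aD, h4, huv.symm, hvw] at this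
    tauto
  rw [pH, card_isClaw_of_path ((aH v w).mpr (.inl h3)) ((aH w z).mpr (.inl h2)) hvz
    (by simp [aH, h4, hvw, huv.symm]), eHL, eHG] at sH
  rw [pL, card_isClaw_of_path ((aL w u).mpr (.inr (.inr ⟨rfl, rfl⟩)))
    ((aL u z).mpr (.inl ((aD u z).mpr ⟨h1, by simp [huw], by simp [huz]⟩))) hwz
    (by simp [aL, aD, huz.symm, huw.symm, hwz.symm]), eLD] at sL
  have cH : Nat.card {x : V // x ≠ v ∧ x ≠ w ∧ x ≠ z ∧ H.Adj x w ∧ ¬ H.Adj x v ∧ ¬ H.Adj x z} =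
      Nat.card {x : V // x ≠ u ∧ x ≠ v ∧ x ≠ w ∧ x ≠ z ∧
        G.Adj x w ∧ ¬ G.Adj x z ∧ ¬ G.Adj x v} :=
    Nat.card_congr (Equiv.subtypeEquivRight fun x => by simp only [aH]; grind)
  have cL : Nat.card {x : V // x ≠ w ∧ x ≠ u ∧ x ≠ z ∧ L.Adj x u ∧ ¬ L.Adj x w ∧ ¬ L.Adj x z} =
      Nat.card {x : V // x ≠ u ∧ x ≠ v ∧ x ≠ w ∧ x ≠ z ∧
        G.Adj x u ∧ ¬ G.Adj x w ∧ ¬ G.Adj x z} :=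
    Nat.card_congr (Equiv.subtypeEquivRight fun x => by simp only [aL, aD]; grind)
  omega

end Claw


/-- Orellana–Scott pairs are distinguished by the Kromatic symmetric function
under a neighbor-count condition.  Here `G.deleteEdges {s(w,z)}` is `G − wz`
and `G ⊔ SimpleGraph.edge a b` is `G` with the edge `ab` added. -/
theorem KSF_ne_of_orellana_scott {V : Type} [Fintype V]
    (G : SimpleGraph V) (u v w z : V)
    (huv : u ≠ v) (huw : u ≠ w) (huz : u ≠ z)
    (hvw : v ≠ w) (hvz : v ≠ z) (hwz : w ≠ z)
    (h1 : G.Adj u z) (h2 : G.Adj w z) (h3 : G.Adj v w)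
    (h4 : ¬ G.Adj u v) (h5 : ¬ G.Adj u w) (h6 : ¬ G.Adj v z)
    (φ : G.deleteEdges {s(w, z)} ≃g G.deleteEdges {s(w, z)})
    (hφu : φ u = z) (hφz : φ z = u) (hφw : φ w = v) (hφv : φ v = w)
    (hcount :
      Nat.card {x : V // x ≠ u ∧ x ≠ v ∧ x ≠ w ∧ x ≠ z ∧
        G.Adj x w ∧ ¬ G.Adj x u ∧ ¬ G.Adj x v}
      + Nat.card {x : V // x ≠ u ∧ x ≠ v ∧ x ≠ w ∧ x ≠ z ∧
        G.Adj x w ∧ ¬ G.Adj x z ∧ ¬ G.Adj x v}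
      ≠
      Nat.card {x : V // x ≠ u ∧ x ≠ v ∧ x ≠ w ∧ x ≠ z ∧
        G.Adj x z ∧ ¬ G.Adj x u ∧ ¬ G.Adj x v}
      + Nat.card {x : V // x ≠ u ∧ x ≠ v ∧ x ≠ w ∧ x ≠ z ∧
        G.Adj x z ∧ ¬ G.Adj x u ∧ ¬ G.Adj x w}) :
    KSF (G ⊔ SimpleGraph.edge u w) ≠ KSF (G ⊔ SimpleGraph.edge v z) := by
  classical
  intro hKSF
  have hφ (x y : V) : (G.deleteEdges {s(w, z)}).Adj (φ x) (φ y) ↔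
      (G.deleteEdges {s(w, z)}).Adj x y := φ.map_rel_iff
  have iu (x : V) : φ x = u ↔ x = z := by
    simpa [hφz] using φ.injective.eq_iff (a := x) (b := z)
  have iv (x : V) : φ x = v ↔ x = w := by
    simpa [hφw] using φ.injective.eq_iff (a := x) (b := w)
  have iw (x : V) : φ x = w ↔ x = v := by
    simpa [hφv] using φ.injective.eq_iff (a := x) (b := v)
  have iz (x : V) : φ x = z ↔ x = u := by
    simpa [hφu] using φ.injective.eq_iff (a := x) (b := u)
  have hiso := card_isClaw_eq_of_iso (K := G.deleteEdges {s(w, z)} ⊔ SimpleGraph.edge u w)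
    (L := G.deleteEdges {s(w, z)} ⊔ SimpleGraph.edge v z) ⟨φ.toEquiv, fun {x y} => by
      change (_ ⊔ _ : SimpleGraph V).Adj (φ x) (φ y) ↔ _
      rw [SimpleGraph.sup_adj, SimpleGraph.sup_adj, hφ, SimpleGraph.edge_adj,
        SimpleGraph.edge_adj, iv, iv, iz, iz, φ.injective.ne_iff]
      tauto⟩
  have hclaw := card_isClaw_eq_of_KSF_eq hKSF
  have hH := card_isClaw_sup_edge G huv huw huz hvw hvz hwz h1 h2 h3 h6
  have hJ := card_isClaw_sup_edge G huv.symm hvz hvw huz huw hwz.symm h3 h2.symm h1 h5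
  rw [Sym2.eq_swap (a := z)] at hJ
  simp only [and_comm (a := z ∈ _) (b := w ∈ _), or_comm (a := v ∈ _) (b := u ∈ _)] at hJ
  have aD (x y : V) : (G.deleteEdges {s(w, z)}).Adj x y ↔
      G.Adj x y ∧ ¬ (x = w ∧ y = z) ∧ ¬ (x = z ∧ y = w) := by
    rw [SimpleGraph.deleteEdges_adj, Set.mem_singleton_iff, Sym2.eq_iff]; tauto
  have hG (x y : V) (hx : x ≠ u ∧ x ≠ v ∧ x ≠ w ∧ x ≠ z) :
      G.Adj x y ↔ G.Adj (φ x) (φ y) := by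
    simpa [aD, iw, iz, hx] using (hφ x y).symm
  have cA : Nat.card {x : V // x ≠ v ∧ x ≠ u ∧ x ≠ z ∧ x ≠ w ∧
        G.Adj x v ∧ ¬ G.Adj x z ∧ ¬ G.Adj x w} =
      Nat.card {x : V // x ≠ u ∧ x ≠ v ∧ x ≠ w ∧ x ≠ z ∧
        G.Adj x w ∧ ¬ G.Adj x u ∧ ¬ G.Adj x v} :=
    Nat.card_congr (φ.toEquiv.subtypeEquiv fun x => by
      change _ ↔ φ x ≠ u ∧ φ x ≠ v ∧ φ x ≠ w ∧ φ x ≠ z ∧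
        G.Adj (φ x) w ∧ ¬ G.Adj (φ x) u ∧ ¬ G.Adj (φ x) v
      have ew := hG x w
      have ev := hG x v
      have ez := hG x z
      rw [hφw] at ew
      rw [hφv] at ev
      rw [hφz] at ez
      simp only [ne_eq, iu, iv, iw, iz]
      clear * - ew ev ez
      tauto)
  have cA' : Nat.card {x : V // x ≠ u ∧ x ≠ v ∧ x ≠ w ∧ x ≠ z ∧
        G.Adj x u ∧ ¬ G.Adj x w ∧ ¬ G.Adj x z} =
      Nat.card {x : V // x ≠ u ∧ x ≠ v ∧ x ≠ w ∧ x ≠ z ∧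
        G.Adj x z ∧ ¬ G.Adj x u ∧ ¬ G.Adj x v} :=
    Nat.card_congr (φ.toEquiv.subtypeEquiv fun x => by
      change _ ↔ φ x ≠ u ∧ φ x ≠ v ∧ φ x ≠ w ∧ φ x ≠ z ∧
        G.Adj (φ x) z ∧ ¬ G.Adj (φ x) u ∧ ¬ G.Adj (φ x) v
      have ew := hG x w
      have eu := hG x u
      have ez := hG x z
      rw [hφw] at ew
      rw [hφu] at eu
      rw [hφz] at ez
      simp only [ne_eq, iu, iv, iw, iz]
      clear * - ew eu ez
      tauto)
  have cB' : Nat.card {x : V // x ≠ v ∧ x ≠ u ∧ x ≠ z ∧ x ≠ w ∧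
        G.Adj x z ∧ ¬ G.Adj x w ∧ ¬ G.Adj x u} =
      Nat.card {x : V // x ≠ u ∧ x ≠ v ∧ x ≠ w ∧ x ≠ z ∧
        G.Adj x z ∧ ¬ G.Adj x u ∧ ¬ G.Adj x w} :=
    Nat.card_congr (Equiv.subtypeEquivRight fun x => by clear * -; tauto)
  omega
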